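/- arXiv:2212.08795 — 4 statements merged into one kernel-verified Lean document; each statement's English description precedes it below -/
import Mathlib

section
/- Let δ ≥ 1 and let G be a δ-regular tree. For every vertex v, every n ≥ 1, and every k with 1 ≤ k ≤ n, the number of closed walks of length 2n at v that visit v exactly k+1 times (counting the start and the end) equals δ^k·(δ−1)^{n−k}·S(n,k), where S(n,k) is the number of Dyck words of semilength n with exactly k returns. -/
/-- `w` is a Dyck word: `true` is an up-step (U), `false` is a down-step (D);
every prefix has at least as many U's as D's, and the whole word is balanced. -/
def IsDyckWord (w : List Bool) : Prop :=
  (∀ i : ℕ, (w.take i).count false ≤ (w.take i).count true) ∧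
    w.count false = w.count true

/-- The number of returns of a word: the number of nonempty balanced prefixes,
i.e. the number of (down-)steps after which the running count of U's minus D's is `0`. -/
def dyckReturns (w : List Bool) : ℕ :=
  ((Finset.Icc 1 w.length).filter
    (fun i => (w.take i).count true = (w.take i).count false)).card

/-- `dyckCount n k` (the quantity `S(n,k)`): the number of Dyck words of
semilength `n` with exactly `k` returns. -/
noncomputable def dyckCount (n k : ℕ) : ℕ :=
  Set.ncard {w : List Bool | w.length = 2 * n ∧ IsDyckWord w ∧ dyckReturns w = k}

/-- The weighted number of nonnegative lattice paths with `m` steps `±1` from height `d` to height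
`0` that visit height `0` exactly `j` times (endpoints included), where an up-step has weight `p`
when it starts at height `0` and weight `q` otherwise. -/
def descentWeight (p q : ℕ) : ℕ → ℕ → ℕ → ℕ
  | 0, 0, j => if j = 1 then 1 else 0
  | 0, _ + 1, _ => 0
  | _ + 1, 0, 0 => 0
  | m + 1, 0, j + 1 => p * descentWeight p q m 1 j
  | m + 1, d + 1, j => descentWeight p q m d j + q * descentWeight p q m (d + 2) j

lemma descentWeight_zero_right (p q m d : ℕ) : descentWeight p q m d 0 = 0 := by
  induction m generalizing d with
  | zero => cases d <;> simp [descentWeight]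
  | succ m ih => cases d <;> simp [descentWeight, ih]

lemma descentWeight_eq_zero_of_lt (p q m d j : ℕ) (h : m < d + 2 * j) :
    descentWeight p q m d (j + 1) = 0 := by
  induction m generalizing d j with
  | zero =>
    cases d with
    | zero => simp only [descentWeight]; rw [if_neg (by lia)]
    | succ d => simp [descentWeight]
  | succ m ih =>
    cases d with
    | zero =>
      cases j with
      | zero => lia
      | succ j => simp [descentWeight, ih 1 j (by lia)]
    | succ d => simp [descentWeight, ih d j (by lia), ih (d + 2) j (by lia)]

/-- A path from height `d` making `j + 1` visits to `0` and `j + b` up-steps has exactly `j`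
up-steps starting at height `0`. -/
lemma descentWeight_eq_mul (p q m d j b : ℕ) (h : m = d + 2 * (j + b)) :
    descentWeight p q m d (j + 1) = p ^ j * q ^ b * descentWeight 1 1 m d (j + 1) := by
  induction m generalizing d j b with
  | zero =>
    obtain ⟨rfl, rfl, rfl⟩ : d = 0 ∧ j = 0 ∧ b = 0 := by lia
    simp [descentWeight]
  | succ m ih =>
    cases d with
    | zero =>
      cases j with
      | zero => simp [descentWeight, descentWeight_zero_right]
      | succ j =>
        simp only [descentWeight]
        rw [ih 1 j b (by lia)]
        ring
    | succ d =>
      simp only [descentWeight]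
      rw [ih d j b (by lia)]
      cases b with
      | zero =>
        rw [descentWeight_eq_zero_of_lt p q m (d + 2) j (by lia),
          descentWeight_eq_zero_of_lt 1 1 m (d + 2) j (by lia)]
        ring
      | succ b =>
        rw [ih (d + 2) j b (by lia)]
        ring

/-- The number of times the lattice path `w` started at height `d` is at height `0`. -/
def zeroVisits (d : ℕ) (w : List Bool) : ℕ :=
  ((Finset.range (w.length + 1)).filter
    (fun i => d + (w.take i).count true = (w.take i).count false)).card

lemma zeroVisits_zero (w : List Bool) : zeroVisits 0 w = dyckReturns w + 1 := by
  have h : Finset.range (w.length + 1) = insert 0 (Finset.Icc 1 w.length) := by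
    ext i
    simp
    lia
  unfold zeroVisits dyckReturns
  rw [h, Finset.filter_insert]
  simp

lemma zeroVisits_cons_true (d : ℕ) (w : List Bool) :
    zeroVisits d (true :: w) = zeroVisits (d + 1) w + if d = 0 then 1 else 0 := by
  unfold zeroVisits
  rw [Finset.card_filter, Finset.card_filter, List.length_cons, Finset.sum_range_succ']
  simp [add_assoc, add_comm 1]

lemma zeroVisits_cons_false (d : ℕ) (w : List Bool) :
    zeroVisits (d + 1) (false :: w) = zeroVisits d w := by
  unfold zeroVisits
  rw [Finset.card_filter, Finset.card_filter, List.length_cons, Finset.sum_range_succ']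
  simp [add_right_comm d 1]

/-- `w` encodes a nonnegative lattice path with `m` steps from height `d` to height `0` that visits
height `0` exactly `j` times. -/
def IsDescentWord (m d j : ℕ) (w : List Bool) : Prop :=
  w.length = m ∧ (∀ i : ℕ, (w.take i).count false ≤ d + (w.take i).count true) ∧
    w.count false = d + w.count true ∧ zeroVisits d w = j

lemma isDescentWord_cons_true (m d j : ℕ) (w : List Bool) :
    IsDescentWord (m + 1) d j (true :: w) ↔
      ∃ i, IsDescentWord m (d + 1) i w ∧ i + (if d = 0 then 1 else 0) = j := by
  unfold IsDescentWord
  rw [zeroVisits_cons_true, ← Nat.and_forall_add_one]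
  simp [add_assoc, add_comm 1, and_assoc]

lemma isDescentWord_cons_false (m d j : ℕ) (w : List Bool) :
    IsDescentWord (m + 1) (d + 1) j (false :: w) ↔ IsDescentWord m d j w := by
  unfold IsDescentWord
  rw [zeroVisits_cons_false, ← Nat.and_forall_add_one]
  simp [add_right_comm d 1]

lemma not_isDescentWord_cons_false (m j : ℕ) (w : List Bool) :
    ¬ IsDescentWord m 0 j (false :: w) := by
  rintro ⟨-, h, -⟩
  simpa using h 1

lemma finite_isDescentWord (m d j : ℕ) : {w | IsDescentWord m d j w}.Finite :=
  (List.finite_length_eq Bool m).subset fun _ h => h.1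

lemma ncard_isDescentWord (m d j : ℕ) :
    Set.ncard {w | IsDescentWord m d j w} = descentWeight 1 1 m d j := by
  induction m generalizing d j with
  | zero =>
    cases d with
    | zero =>
      by_cases hj : j = 1
      · have : {w | IsDescentWord 0 0 j w} = {[]} := by
          ext w
          cases w <;> simp [IsDescentWord, zeroVisits, hj]
        rw [this, Set.ncard_singleton, hj]
        rfl
      · have : {w | IsDescentWord 0 0 j w} = ∅ := by
          ext w
          cases w <;> simp [IsDescentWord, zeroVisits, Ne.symm hj]
        simp [this, descentWeight, hj]
    | succ d =>
      have : {w | IsDescentWord 0 (d + 1) j w} = ∅ := by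
        ext w
        cases w <;> simp [IsDescentWord]
      simp [this, descentWeight]
  | succ m ih =>
    cases d with
    | zero =>
      cases j with
      | zero =>
        have : {w | IsDescentWord (m + 1) 0 0 w} = ∅ := by
          ext w
          rcases w with _ | ⟨_ | _, w⟩
          · simp [IsDescentWord]
          · simp [not_isDescentWord_cons_false]
          · simp [isDescentWord_cons_true]
        simp [this, descentWeight]
      | succ j =>
        have : {w | IsDescentWord (m + 1) 0 (j + 1) w} =
            List.cons true '' {w | IsDescentWord m 1 j w} := by
          ext w
          rcases w with _ | ⟨_ | _, w⟩
          · simp [IsDescentWord]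
          · simp [not_isDescentWord_cons_false]
          · simp [isDescentWord_cons_true]
        rw [this, Set.ncard_image_of_injective _ List.cons_injective, ih]
        simp [descentWeight]
    | succ d =>
      have : {w | IsDescentWord (m + 1) (d + 1) j w} =
          List.cons false '' {w | IsDescentWord m d j w} ∪
            List.cons true '' {w | IsDescentWord m (d + 2) j w} := by
        ext w
        rcases w with _ | ⟨_ | _, w⟩
        · simp [IsDescentWord]
        · simp [isDescentWord_cons_false]
        · simp [isDescentWord_cons_true]
      rw [this, Set.ncard_union_eq _ ((finite_isDescentWord _ _ _).image _)
        ((finite_isDescentWord _ _ _).image _), Set.ncard_image_of_injective _ List.cons_injective,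
        Set.ncard_image_of_injective _ List.cons_injective, ih, ih]
      · simp [descentWeight]
      · rw [Set.disjoint_left]
        rintro _ ⟨x, -, rfl⟩ ⟨y, -, h⟩
        simp at h

namespace SimpleGraph

variable {V : Type*} {G : SimpleGraph V}

/-- In a tree, a vertex other than `v` has exactly one neighbor closer to `v`. -/
lemma IsTree.existsUnique_adj_dist_add_one (hG : G.IsTree) {u v : V} (huv : u ≠ v) :
    ∃! w, G.Adj u w ∧ G.dist w v + 1 = G.dist u v := by
  obtain ⟨p, hp⟩ := hG.connected.exists_walk_length_eq_dist u v
  cases p with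
  | nil => exact absurd rfl huv
  | @cons _ w _ h p =>
    rw [Walk.length_cons] at hp
    have hle := dist_le p
    have htri := hG.connected.dist_triangle (u := u) (v := w) (w := v)
    rw [dist_eq_one_iff_adj.mpr h] at htri
    refine ⟨w, ⟨h, by lia⟩, ?_⟩
    rintro w' ⟨h', hw'⟩
    obtain ⟨p', hp'⟩ := hG.connected.exists_walk_length_eq_dist w' v
    have h₁ := (Walk.cons h p).isPath_of_length_eq_dist (by simp; lia)
    have h₂ := (Walk.cons h' p').isPath_of_length_eq_dist (by simp; lia)
    have heq := (hG.existsUnique_path u v).unique h₂ h₁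
    injection heq

variable [DecidableEq V] [G.LocallyFinite]

lemma card_filter_finsetWalkLength_succ (m : ℕ) (u v : V) (j : ℕ) :
    ((G.finsetWalkLength (m + 1) u v).filter fun p => p.support.count v = j).card =
      ∑ w ∈ G.neighborFinset u, ((G.finsetWalkLength m w v).filter
        fun p => p.support.count v + (if u = v then 1 else 0) = j).card := by
  rw [finsetWalkLength, Finset.filter_biUnion, Finset.card_biUnion]
  · rw [← Finset.sum_coe_sort (G.neighborFinset u)]
    refine Finset.sum_bij' (fun w _ => ⟨w.1, (mem_neighborFinset _ _ _).mpr w.2⟩)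
      (fun w _ => ⟨w.1, (mem_neighborFinset _ _ _).mp w.2⟩) (by simp) (by simp) (by simp) (by simp)
      ?_
    intro w _
    rw [Finset.filter_map, Finset.card_map]
    refine congrArg Finset.card (Finset.filter_congr fun p _ => ?_)
    change (u :: p.support).count v = j ↔ _
    simp [List.count_cons]
  · intro x _ y _ hxy
    rw [Function.onFun, Finset.disjoint_left]
    intro p hx hy
    simp only [Finset.mem_filter, Finset.mem_map] at hx hy
    obtain ⟨⟨p₁, -, rfl⟩, -⟩ := hx
    obtain ⟨⟨p₂, -, h⟩, -⟩ := hy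
    injection h with _ h₁
    exact hxy (Subtype.ext h₁.symm)

lemma card_filter_finsetWalkLength {δ : ℕ} (hreg : G.IsRegularOfDegree δ) (hG : G.IsTree)
    (m : ℕ) (u v : V) (j : ℕ) :
    ((G.finsetWalkLength m u v).filter fun p => p.support.count v = j).card =
      descentWeight δ (δ - 1) m (G.dist u v) j := by
  induction m generalizing u j with
  | zero =>
    by_cases huv : u = v
    · subst huv
      simp [finsetWalkLength, Finset.filter_singleton, descentWeight, apply_ite, eq_comm]
    · obtain ⟨d, hd⟩ := Nat.exists_eq_add_one.mpr (hG.connected.pos_dist_of_ne huv)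
      simp [finsetWalkLength, huv, hd, descentWeight]
  | succ m ih =>
    rw [card_filter_finsetWalkLength_succ]
    by_cases huv : u = v
    · subst huv
      cases j with
      | zero => simp [descentWeight]
      | succ j =>
        simp only [if_true, add_left_inj, ih]
        rw [Finset.sum_congr rfl (g := fun _ => descentWeight δ (δ - 1) m 1 j)]
        · simp [descentWeight, hreg.degree_eq]
        · intro w hw
          rw [dist_eq_one_iff_adj.mpr ((mem_neighborFinset _ _ _).mp hw).symm]
    · obtain ⟨d, hd⟩ := Nat.exists_eq_add_one.mpr (hG.connected.pos_dist_of_ne huv)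
      obtain ⟨w, ⟨hw, hwd⟩, huniq⟩ := hG.existsUnique_adj_dist_add_one huv
      have hmem : w ∈ G.neighborFinset u := (mem_neighborFinset _ _ _).mpr hw
      simp only [if_neg huv, add_zero, ih]
      rw [← Finset.add_sum_erase _ _ hmem, Finset.sum_congr rfl
        (g := fun _ => descentWeight δ (δ - 1) m (d + 2) j)]
      · rw [Finset.sum_const, Finset.card_erase_of_mem hmem, card_neighborFinset_eq_degree,
          hreg.degree_eq, hd, show G.dist w v = d by lia]
        simp [descentWeight]
      · intro x hx
        rw [Finset.mem_erase, mem_neighborFinset] at hx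
        have h₁ := hG.dist_eq_dist_add_one_of_adj v hx.2
        rw [dist_comm (u := v), dist_comm (u := v)] at h₁
        rcases h₁ with h₁ | h₁
        · exact absurd (huniq x ⟨hx.2, h₁.symm⟩) hx.1
        · rw [h₁, hd]

end SimpleGraph

/-- In a δ-regular tree, the number of closed walks of length 2n at a vertex v
that visit v exactly k+1 times (counting start and end) is
δ^k * (δ-1)^(n-k) * S(n,k). -/
theorem closed_walks_with_k_components {V : Type*} [DecidableEq V]
    (G : SimpleGraph V) [G.LocallyFinite] (δ : ℕ) (hδ : 1 ≤ δ)
    (hreg : G.IsRegularOfDegree δ) (htree : G.IsTree) (v : V)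
    (n k : ℕ) (hn : 1 ≤ n) (hk : 1 ≤ k) (hkn : k ≤ n) :
    Set.ncard {p : G.Walk v v | p.length = 2 * n ∧ p.support.count v = k + 1}
      = δ ^ k * (δ - 1) ^ (n - k) * dyckCount n k := by
  obtain ⟨b, rfl⟩ := Nat.exists_eq_add_of_le hkn
  have hset : {p : G.Walk v v | p.length = 2 * (k + b) ∧ p.support.count v = k + 1} =
      ((G.finsetWalkLength (2 * (k + b)) v v).filter fun p => p.support.count v = k + 1 :) := by
    ext p
    simp [SimpleGraph.mem_finsetWalkLength_iff]
  have hdyck : dyckCount (k + b) k =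
      Set.ncard {w | IsDescentWord (2 * (k + b)) 0 (k + 1) w} := by
    unfold dyckCount
    congr 1
    ext w
    simp [IsDescentWord, IsDyckWord, zeroVisits_zero, and_assoc]
  rw [hset, Set.ncard_coe_finset, hdyck, ncard_isDescentWord,
    SimpleGraph.card_filter_finsetWalkLength hreg htree]
  have h := descentWeight_eq_mul δ (δ - 1) (0 + 2 * (k + b)) 0 k b rfl
  simpa using h
end

section
/- Let δ ≥ 1, n ≥ 1, and let G be a finite δ-regular simple graph whose girth is strictly greater than 2n. For every vertex v, the number W_{2n} of closed walks of length 2n at v satisfies W_{2n} = ∑_{k=1}^{n} δ^k·(δ−1)^{n−k}·( ∑_{j=k−1}^{n−1} S(n−1,j) ), where S(n,k) is the number of Dyck words of semilength n with exactly k returns. -/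
/-- The number of walks of length `m` on the half-line from `h` to `0`, staying nonnegative and
visiting `0` exactly `k` times after the start. -/
def ballotCount : ℕ → ℕ → ℕ → ℕ
  | 0, 0, 0 => 1
  | 0, _, _ => 0
  | m + 1, 0, k => ballotCount m 1 k
  | m + 1, 1, 0 => ballotCount m 2 0
  | m + 1, 1, k + 1 => ballotCount m 0 k + ballotCount m 2 (k + 1)
  | m + 1, h + 2, k => ballotCount m (h + 1) k + ballotCount m (h + 3) k

lemma ballotCount_succ_zero (m k : ℕ) : ballotCount (m + 1) 0 k = ballotCount m 1 k := rfl

lemma ballotCount_succ_one_succ (m k : ℕ) :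
    ballotCount (m + 1) 1 (k + 1) = ballotCount m 0 k + ballotCount m 2 (k + 1) := rfl

lemma ballotCount_succ_add_two (m h k : ℕ) :
    ballotCount (m + 1) (h + 2) k = ballotCount m (h + 1) k + ballotCount m (h + 3) k := by
  rw [ballotCount]

lemma ballotCount_add_one_zero (m h : ℕ) : ballotCount m (h + 1) 0 = 0 := by
  induction m generalizing h with
  | zero => simp [ballotCount]
  | succ m ih => rcases h with _ | h <;> simp [ballotCount, ih]

/-- The words of length `m` which, read from height `h`, stay nonnegative, end at height `0`
and visit height `0` exactly `k` times after the start. -/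
def ballotWords (m h k : ℕ) : Set (List Bool) :=
  {w | w.length = m ∧ (∀ i : ℕ, (w.take i).count false ≤ h + (w.take i).count true) ∧
    w.count false = h + w.count true ∧
    (∑ i ∈ Finset.range w.length,
      if h + (w.take (i + 1)).count true = (w.take (i + 1)).count false then 1 else 0) = k}

lemma finite_ballotWords (m h k : ℕ) : (ballotWords m h k).Finite :=
  (List.finite_length_eq Bool m).subset fun _ hw => hw.1

lemma nil_mem_ballotWords {m h k : ℕ} : [] ∈ ballotWords m h k ↔ m = 0 ∧ h = 0 ∧ k = 0 := by
  simp [ballotWords, eq_comm]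

lemma true_cons_mem_ballotWords {m h k : ℕ} {w : List Bool} :
    true :: w ∈ ballotWords (m + 1) h k ↔ w ∈ ballotWords m (h + 1) k := by
  have e : ∀ a b : ℕ, h + (a + 1) = b ↔ h + 1 + a = b := fun a b => by omega
  simp only [ballotWords, Set.mem_ofPred_eq, List.length_cons, Finset.sum_range_succ',
    List.take_succ_cons, List.count_cons]
  refine and_congr (add_left_inj 1) (and_congr ⟨fun H i => ?_, fun H i => ?_⟩ (and_congr ?_ ?_))
  · have := H (i + 1)
    simp at this
    omega
  · cases i with
    | zero => simp
    | succ i =>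
      have := H i
      simp
      omega
  · simp; omega
  · simp [e]

lemma false_cons_notMem_ballotWords_zero {m k : ℕ} {w : List Bool} :
    false :: w ∉ ballotWords m 0 k := fun H => by
  simpa using H.2.1 1

lemma false_cons_mem_ballotWords {m h k : ℕ} {w : List Bool} :
    false :: w ∈ ballotWords (m + 1) (h + 1) k ↔
      ∃ j, j + (if h = 0 then 1 else 0) = k ∧ w ∈ ballotWords m h j := by
  have e : ∀ a b : ℕ, h + 1 + a = b + 1 ↔ h + a = b := fun a b => by omega
  simp only [ballotWords, Set.mem_ofPred_eq, List.length_cons, Finset.sum_range_succ',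
    List.take_succ_cons, List.count_cons]
  constructor
  · rintro ⟨hl, H, hc, hs⟩
    refine ⟨_, ?_, by omega, fun i => ?_, by simp at hc; omega, rfl⟩
    · simpa [e] using hs
    · have := H (i + 1)
      simp at this
      omega
  · rintro ⟨j, hj, hl, H, hc, hs⟩
    refine ⟨by omega, fun i => ?_, by simp; omega, ?_⟩
    · cases i with
      | zero => simp
      | succ i =>
        have := H i
        simp
        omega
    · simpa [e, hs] using hj

lemma ncard_ballotWords (m h k : ℕ) : (ballotWords m h k).ncard = ballotCount m h k := by
  induction m generalizing h k with
  | zero =>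
    have hsub : ∀ w ∈ ballotWords 0 h k, w = [] := fun w hw => List.length_eq_zero_iff.1 hw.1
    by_cases hz : h = 0 ∧ k = 0
    · have : ballotWords 0 h k = {[]} := by
        ext w
        exact ⟨hsub w, fun hw => by rw [Set.mem_singleton_iff.1 hw, nil_mem_ballotWords]; tauto⟩
      rw [this, Set.ncard_singleton, hz.1, hz.2, ballotCount]
    · have : ballotWords 0 h k = ∅ := by
        refine Set.eq_empty_of_forall_notMem fun w hw => ?_
        rw [hsub w hw, nil_mem_ballotWords] at hw
        tauto
      rw [this, Set.ncard_empty]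
      rcases h with _ | h <;> rcases k with _ | k <;> simp_all [ballotCount]
  | succ m ih =>
    have inj : ∀ b : Bool, Function.Injective (List.cons b) := fun b => List.cons_injective
    have only_true : (∀ w, false :: w ∉ ballotWords (m + 1) h k) →
        (ballotWords (m + 1) h k).ncard = ballotCount m (h + 1) k := by
      intro hf
      rw [← ih, ← Set.ncard_image_of_injective (ballotWords m (h + 1) k) (inj true)]
      congr 1
      ext w
      rcases w with _ | ⟨_ | _, w⟩
      · simp [nil_mem_ballotWords]
      · simp [hf]
      · simp [true_cons_mem_ballotWords]
    have both : ∀ h' j, (∀ w, false :: w ∈ ballotWords (m + 1) h k ↔ w ∈ ballotWords m h' j) →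
        (ballotWords (m + 1) h k).ncard = ballotCount m h' j + ballotCount m (h + 1) k := by
      intro h' j hf
      rw [← ih, ← ih, ← Set.ncard_image_of_injective (ballotWords m (h + 1) k) (inj true),
        ← Set.ncard_image_of_injective (ballotWords m h' j) (inj false),
        ← Set.ncard_union_eq _ ((finite_ballotWords ..).image _) ((finite_ballotWords ..).image _)]
      · congr 1
        ext w
        rcases w with _ | ⟨_ | _, w⟩
        · simp [nil_mem_ballotWords]
        · simp [hf]
        · simp [true_cons_mem_ballotWords]
      · rw [Set.disjoint_left]
        rintro _ ⟨a, -, rfl⟩ ⟨b, -, hb⟩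
        simp at hb
    rcases h with _ | _ | h
    · rw [only_true fun _ => false_cons_notMem_ballotWords_zero, ballotCount]
    · rcases k with _ | k
      · rw [only_true fun w => by simp [false_cons_mem_ballotWords], ballotCount]
      · rw [both 0 k fun w => by simp [false_cons_mem_ballotWords], ballotCount]
    · rw [both (h + 1) k fun w => by simp [false_cons_mem_ballotWords], ballotCount]

lemma dyckCount_eq_ballotCount (n k : ℕ) : dyckCount n k = ballotCount (2 * n) 0 k := by
  rw [← ncard_ballotWords, dyckCount]
  congr 1
  ext w
  have hret : dyckReturns w = ∑ i ∈ Finset.range w.length,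
      if (w.take (i + 1)).count true = (w.take (i + 1)).count false then 1 else 0 := by
    rw [dyckReturns, Finset.card_filter, Finset.range_eq_Ico,
      Finset.sum_Ico_add' (fun i => if (w.take i).count true = (w.take i).count false then 1 else 0)]
    rfl
  simp [ballotWords, IsDyckWord, hret, and_assoc]

lemma ballotCount_eq_zero (m h k : ℕ) (hlt : m + (if h = 0 then 0 else 2) < h + 2 * k) :
    ballotCount m h k = 0 := by
  induction m generalizing h k with
  | zero => rcases h with _ | h <;> rcases k with _ | k <;> simp_all [ballotCount]
  | succ m ih =>
    rcases h with _ | _ | h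
    · rw [ballotCount, ih]
      simp at hlt ⊢; omega
    · rcases k with _ | k
      · simp at hlt
      · rw [ballotCount, ih, ih] <;> simp at hlt ⊢ <;> omega
    · rw [ballotCount, ih, ih] <;> simp at hlt ⊢ <;> omega

lemma ballotCount_trade (m h k : ℕ) :
    ballotCount m (h + 2) (k + 1) = ballotCount (m + 1) (h + 1) (k + 2) := by
  induction m generalizing h k with
  | zero => rcases h with _ | h <;> simp [ballotCount]
  | succ m ih =>
    rcases h with _ | h
    · rw [ballotCount_succ_one_succ, ballotCount_succ_zero, ← ih,
        ballotCount_succ_add_two, zero_add]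
    · rw [ballotCount_succ_add_two, ballotCount_succ_add_two, ih, ih]

lemma ballotCount_add_two_zero (m k : ℕ) :
    ballotCount (m + 2) 0 (k + 1) = ballotCount m 0 k + ballotCount (m + 2) 0 (k + 2) := by
  rw [ballotCount_succ_zero, ballotCount_succ_one_succ, ballotCount_trade m 0,
    ballotCount_succ_zero]

lemma sum_Icc_ballotCount {n k : ℕ} (hk : k ≤ n + 1) :
    ∑ j ∈ Finset.Icc k n, ballotCount (2 * n) 0 j = ballotCount (2 * n + 2) 0 (k + 1) := by
  induction hk using Nat.decreasingInduction with
  | self => rw [Finset.Icc_eq_empty (by omega), Finset.sum_empty, ballotCount_eq_zero]; simp; omega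
  | of_succ k hk ih =>
    rw [← Finset.add_sum_Ioc_eq_sum_Icc (by omega), ← Finset.Icc_add_one_left_eq_Ioc, ih,
      ← ballotCount_add_two_zero]

/-- The number of walks of length `m` to the root of a `δ`-regular tree from a vertex at
distance `d` from the root. -/
def treeWalkCount (δ : ℕ) : ℕ → ℕ → ℕ
  | 0, 0 => 1
  | 0, _ + 1 => 0
  | m + 1, 0 => δ * treeWalkCount δ m 1
  | m + 1, d + 1 => treeWalkCount δ m d + (δ - 1) * treeWalkCount δ m (d + 2)

lemma treeWalkCount_eq_zero (δ : ℕ) {m d : ℕ} (h : m < d) : treeWalkCount δ m d = 0 := by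
  induction m generalizing d with
  | zero => obtain ⟨d, rfl⟩ := Nat.exists_eq_succ_of_ne_zero h.ne'; rfl
  | succ m ih =>
    obtain ⟨d, rfl⟩ := Nat.exists_eq_succ_of_ne_zero (Nat.ne_zero_of_lt h)
    rw [treeWalkCount, ih (by omega), ih (by omega), mul_zero, add_zero]

lemma treeWalkCount_eq_sum_ballotCount (δ m : ℕ) :
    (∀ u, m = 2 * u → treeWalkCount δ m 0 =
      ∑ k ∈ Finset.range (u + 1), δ ^ k * (δ - 1) ^ (u - k) * ballotCount m 0 k) ∧
    ∀ d u, m = d + 1 + 2 * u → treeWalkCount δ m (d + 1) =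
      ∑ k ∈ Finset.range (u + 1), δ ^ k * (δ - 1) ^ (u - k) * ballotCount m (d + 1) (k + 1) := by
  induction m with
  | zero =>
    refine ⟨fun u hu => ?_, fun d u hu => by omega⟩
    obtain rfl : u = 0 := by omega
    simp [treeWalkCount, ballotCount]
  | succ m ih =>
    have up : ∀ d u, m = d + 2 + 2 * u → (δ - 1) * treeWalkCount δ m (d + 2) =
        ∑ k ∈ Finset.range (u + 2),
          δ ^ k * (δ - 1) ^ (u + 1 - k) * ballotCount m (d + 2) (k + 1) := by
      intro d u hm
      rw [ih.2 (d + 1) u hm, Finset.sum_range_succ _ (u + 1), Finset.mul_sum,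
        ballotCount_eq_zero m (d + 2) (u + 1 + 1) (by simp; omega), mul_zero, add_zero]
      refine Finset.sum_congr rfl fun k hk => ?_
      rw [Nat.sub_add_comm (by simp at hk; omega), pow_succ]
      ring
    refine ⟨fun u hu => ?_, fun d u hu => ?_⟩
    · obtain ⟨u, rfl⟩ : ∃ u', u = u' + 1 := ⟨u - 1, by omega⟩
      rw [treeWalkCount, ih.2 0 u (by omega), Finset.sum_range_succ' _ (u + 1),
        ballotCount_succ_zero, ballotCount_add_one_zero, mul_zero, add_zero, Finset.mul_sum]
      refine Finset.sum_congr rfl fun k _ => ?_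
      rw [ballotCount_succ_zero, Nat.add_sub_add_right]
      ring
    · have expand : ∀ k, ballotCount (m + 1) (d + 1) (k + 1) =
          ballotCount m d (k + if d = 0 then 0 else 1) + ballotCount m (d + 2) (k + 1) := by
        intro k
        rcases d with _ | d
        · simp [ballotCount_succ_one_succ]
        · simp [ballotCount_succ_add_two]
      have down : treeWalkCount δ m d = ∑ k ∈ Finset.range (u + 1),
          δ ^ k * (δ - 1) ^ (u - k) * ballotCount m d (k + if d = 0 then 0 else 1) := by
        rcases d with _ | d
        · simpa using ih.1 u (by omega)
        · simpa using ih.2 d u (by omega)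
      rw [treeWalkCount, down]
      simp only [expand, mul_add, Finset.sum_add_distrib]
      congr 1
      rcases u with _ | u
      · rw [treeWalkCount_eq_zero δ (by omega)]
        simp [ballotCount_eq_zero m (d + 2) 1 (by simp; omega)]
      · exact up d u (by omega)

namespace SimpleGraph

variable {V : Type*}

lemma Walk.IsPath.notMem_support_of_lt_girth {G : SimpleGraph V} {u v w x : V}
    {h : G.Adj u w} {q : G.Walk w v} (hp : (Walk.cons h q).IsPath) (hx : G.Adj x u) (hne : x ≠ w)
    (hlen : q.length + 2 < G.girth) : x ∉ (Walk.cons h q).support := by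
  classical
  intro hmem
  have hcyc : (Walk.cons hx ((Walk.cons h q).takeUntil x hmem)).IsCycle := by
    refine Walk.cons_isCycle_iff _ _ |>.2 ⟨hp.takeUntil hmem, fun he => ?_⟩
    have he' := Walk.edges_takeUntil_subset_edges _ hmem he
    rw [Walk.edges_cons, List.mem_cons] at he'
    rcases he' with he' | he'
    · rw [Sym2.eq_swap, Sym2.congr_right] at he'
      exact hne he'
    · exact ((Walk.cons_isPath_iff _ _).1 hp).2 (Walk.snd_mem_support_of_mem_edges _ he')
  have h1 := hcyc.girth_le_length
  have h2 := Walk.length_takeUntil_le_length _ hmem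
  simp only [Walk.length_cons] at h1 h2
  omega

lemma adjMatrix_pow_eq_treeWalkCount [Fintype V] [DecidableEq V] {G : SimpleGraph V}
    [DecidableRel G.Adj] {δ : ℕ} (hreg : ∀ x, (G.neighborFinset x).card = δ) {v : V} (m : ℕ)
    {u : V} (p : G.Walk u v) (hp : p.IsPath) (hlen : p.length + m < G.girth) :
    (G.adjMatrix ℕ ^ m) u v = treeWalkCount δ m p.length := by
  induction m generalizing u with
  | zero =>
    cases p with
    | nil => simp [treeWalkCount]
    | cons h q =>
      have : u ≠ v := by
        rintro rfl
        exact ((Walk.cons_isPath_iff _ _).1 hp).2 q.end_mem_support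
      simp [treeWalkCount, this]
  | succ m ih =>
    rw [pow_succ', adjMatrix_mul_apply]
    cases p with
    | nil =>
      simp only [Walk.length_nil, zero_add] at hlen
      have key : ∀ x ∈ G.neighborFinset v, (G.adjMatrix ℕ ^ m) x v = treeWalkCount δ m 1 := by
        intro x hx
        have hxv : G.Adj x v := ((G.mem_neighborFinset _ _).1 hx).symm
        exact ih (Walk.cons hxv .nil) (by simpa using hxv.ne) (by simp; omega)
      rw [Finset.sum_congr rfl key, Finset.sum_const, hreg, smul_eq_mul, Walk.length_nil,
        treeWalkCount]
    | @cons _ w _ h q =>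
      have hw : w ∈ G.neighborFinset u := (G.mem_neighborFinset _ _).2 h
      simp only [Walk.length_cons] at hlen
      rw [← Finset.add_sum_erase _ _ hw, ih q ((Walk.cons_isPath_iff _ _).1 hp).1 (by omega),
        Walk.length_cons, treeWalkCount]
      congr 1
      have key : ∀ x ∈ (G.neighborFinset u).erase w,
          (G.adjMatrix ℕ ^ m) x v = treeWalkCount δ m (q.length + 2) := by
        intro x hx
        obtain ⟨hne, hx⟩ := Finset.mem_erase.1 hx
        have hxu : G.Adj x u := ((G.mem_neighborFinset _ _).1 hx).symm
        exact ih (Walk.cons hxu (Walk.cons h q)) ((Walk.cons_isPath_iff _ _).2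
          ⟨hp, hp.notMem_support_of_lt_girth hxu hne (by omega)⟩) (by simp; omega)
      rw [Finset.sum_congr rfl key, Finset.sum_const, Finset.card_erase_of_mem hw, hreg, smul_eq_mul]

end SimpleGraph

/-- In a finite δ-regular graph of girth greater than 2n, the number of closed
walks of length 2n at a vertex v equals the stated double sum involving
S(n-1, j). -/
theorem closed_walks_large_girth_count {V : Type*} [Fintype V]
    (G : SimpleGraph V) [G.LocallyFinite] (δ : ℕ) (hδ : 1 ≤ δ)
    (hreg : G.IsRegularOfDegree δ) (n : ℕ) (hn : 1 ≤ n)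
    (hgirth : (2 * n : ℕ∞) < G.girth) (v : V) :
    Set.ncard {p : G.Walk v v | p.length = 2 * n}
      = ∑ k ∈ Finset.Icc 1 n, δ ^ k * (δ - 1) ^ (n - k) *
          ∑ j ∈ Finset.Icc (k - 1) (n - 1), dyckCount (n - 1) j := by
  classical
  have hlt : 2 * n < G.girth := by exact_mod_cast hgirth
  have hcard : Set.ncard {p : G.Walk v v | p.length = 2 * n} = (G.adjMatrix ℕ ^ (2 * n)) v v := by
    rw [SimpleGraph.adjMatrix_pow_apply_eq_card_walk, ← Nat.card_coe_set_eq,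
      Nat.card_eq_fintype_card, Nat.cast_id]
    congr!
  have hdeg : ∀ x, (G.neighborFinset x).card = δ := fun x => by
    rw [← hreg x, ← G.card_neighborFinset_eq_degree]
  have htree := SimpleGraph.adjMatrix_pow_eq_treeWalkCount (G := G) (δ := δ)
    (fun x => by convert hdeg x) (2 * n) (SimpleGraph.Walk.nil (u := v)) .nil (by simpa using hlt)
  rw [hcard, htree, SimpleGraph.Walk.length_nil,
    (treeWalkCount_eq_sum_ballotCount δ (2 * n)).1 n rfl, Finset.range_eq_Ico,
    Finset.sum_eq_sum_Ico_succ_bot (by omega)]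
  obtain ⟨n, rfl⟩ : ∃ n', n = n' + 1 := ⟨n - 1, by omega⟩
  rw [show ballotCount (2 * (n + 1)) 0 0 = 0 from ballotCount_add_one_zero (2 * n + 1) 0,
    mul_zero, zero_add]
  refine Finset.sum_congr rfl fun k hk => ?_
  obtain ⟨hk1, hk2⟩ := Finset.mem_Ico.1 hk
  obtain ⟨k, rfl⟩ : ∃ k', k = k' + 1 := ⟨k - 1, by omega⟩
  simp only [dyckCount_eq_ballotCount, Nat.add_sub_cancel]
  rw [sum_Icc_ballotCount (by omega), Nat.mul_succ]
end

section
/- For all integers n, k with 1 ≤ k ≤ n, the Catalan triangle entry C(n−1, n−k) equals the number of Dyck words of semilength n−1 with at least k−1 returns; that is, C(n−1, n−k) = ∑_{j=k−1}^{n−1} S(n−1,j). -/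
/-- The Catalan triangle entry `C(n,k) = choose (n+k) k - choose (n+k) (k-1)`
(with the convention that the binomial coefficient at index `-1` is `0`). -/
def catalanTriangle (n k : ℕ) : ℕ :=
  (n + k).choose k - if k = 0 then 0 else (n + k).choose (k - 1)

/-- The Borel triangle entry `B(n,k) = ∑_{s=k}^{n} choose s k * C(n,s)`. -/
def borelTriangle (n k : ℕ) : ℕ :=
  ∑ s ∈ Finset.Icc k n, s.choose k * catalanTriangle n s

/-- Starting from height `h`, the word `w` never goes below height `0`, ends at height `0`,
and visits height `0` after at least `r` of its steps. -/
def DescendsToZero : List Bool → ℕ → ℕ → Prop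
  | [], h, r => h = 0 ∧ r = 0
  | true :: w, h, r => DescendsToZero w (h + 1) r
  | false :: _, 0, _ => False
  | false :: w, 1, r => DescendsToZero w 0 (r - 1)
  | false :: w, h + 2, r => DescendsToZero w (h + 1) r

/-- The number of visits to height `0`, after at least one step, of the word `w` started at
height `h`. -/
def visitsToZero (h : ℕ) (w : List Bool) : ℕ :=
  ∑ i ∈ Finset.range w.length,
    if h + (w.take (i + 1)).count true = (w.take (i + 1)).count false then 1 else 0

theorem visitsToZero_zero_left (w : List Bool) : visitsToZero 0 w = dyckReturns w := by
  rw [visitsToZero, dyckReturns, Finset.card_filter, Finset.range_eq_Ico,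
    Finset.sum_Ico_add' (fun i => if 0 + (w.take i).count true = (w.take i).count false
      then 1 else 0) 0 w.length 1]
  simp only [zero_add]
  rfl

theorem visitsToZero_cons_true (h : ℕ) (w : List Bool) :
    visitsToZero h (true :: w) = visitsToZero (h + 1) w := by
  simp only [visitsToZero, List.length_cons, Finset.sum_range_succ']
  simp [List.take_succ_cons, add_assoc, add_comm 1]

theorem visitsToZero_cons_false (h : ℕ) (w : List Bool) :
    visitsToZero (h + 1) (false :: w) = visitsToZero h w + if h = 0 then 1 else 0 := by
  simp only [visitsToZero, List.length_cons, Finset.sum_range_succ']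
  simp [List.take_succ_cons, add_right_comm h 1]

theorem forall_count_take_cons (h : ℕ) (b : Bool) (w : List Bool) :
    (∀ i, ((b :: w).take i).count false ≤ h + ((b :: w).take i).count true) ↔
      ∀ i, (w.take i).count false + [b].count false
        ≤ h + ((w.take i).count true + [b].count true) := by
  constructor
  · intro H i
    simpa [List.take_succ_cons, List.count_cons] using H (i + 1)
  · rintro H (_ | i)
    · simp
    · simpa [List.take_succ_cons, List.count_cons] using H i

theorem descendsToZero_iff (w : List Bool) (h r : ℕ) :
    DescendsToZero w h r ↔
      (∀ i, (w.take i).count false ≤ h + (w.take i).count true) ∧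
        w.count false = h + w.count true ∧ r ≤ visitsToZero h w := by
  induction w generalizing h r with
  | nil => simp [DescendsToZero, visitsToZero, eq_comm]
  | cons b w ih =>
    rw [forall_count_take_cons]
    cases b with
    | true =>
      rw [DescendsToZero, ih, visitsToZero_cons_true]
      simp [add_assoc, add_comm 1]
    | false =>
      match h with
      | 0 =>
        simp only [DescendsToZero, false_iff]
        rintro ⟨H, -⟩
        simpa using H 0
      | 1 =>
        rw [DescendsToZero, ih, visitsToZero_cons_false 0]
        simp [add_comm 1]
      | h + 2 =>
        rw [DescendsToZero, ih, visitsToZero_cons_false (h + 1)]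
        simp only [List.count_cons]
        grind

theorem descendsToZero_zero_iff (w : List Bool) (r : ℕ) :
    DescendsToZero w 0 r ↔ IsDyckWord w ∧ r ≤ dyckReturns w := by
  simp [descendsToZero_iff, visitsToZero_zero_left, IsDyckWord, and_assoc]

theorem DescendsToZero.le_length {w : List Bool} {h r : ℕ} (H : DescendsToZero w h r) :
    h ≤ w.length ∧ 2 * r ≤ w.length + h := by
  induction w generalizing h r with
  | nil => simp_all [DescendsToZero]
  | cons b w ih =>
    match b, h with
    | true, h => have := ih (h := h + 1) (r := r) H; grind
    | false, 0 => exact H.elim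
    | false, 1 => have := ih (h := 0) (r := r - 1) H; grind
    | false, h + 2 => have := ih (h := h + 1) (r := r) H; grind

/-- The number of words of length `L` satisfying `DescendsToZero · h r`. -/
noncomputable def descentCount (L h r : ℕ) : ℕ :=
  Set.ncard {w : List Bool | w.length = L ∧ DescendsToZero w h r}

theorem descentCount_zero (h r : ℕ) :
    descentCount 0 h r = if h = 0 ∧ r = 0 then 1 else 0 := by
  have : {w : List Bool | w.length = 0 ∧ DescendsToZero w h r} =
      if h = 0 ∧ r = 0 then {[]} else ∅ := by
    ext w
    cases w <;> split_ifs <;> simp_all [DescendsToZero]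
  rw [descentCount, this]
  split_ifs <;> simp

theorem ncard_length_succ (L : ℕ) (p : List Bool → Prop) :
    Set.ncard {w : List Bool | w.length = L + 1 ∧ p w} =
      Set.ncard {w : List Bool | w.length = L ∧ p (true :: w)} +
        Set.ncard {w : List Bool | w.length = L ∧ p (false :: w)} := by
  have hfin (q : List Bool → Prop) : {w : List Bool | w.length = L ∧ q w}.Finite :=
    (List.finite_length_eq Bool L).subset fun w hw => hw.1
  have hunion : {w : List Bool | w.length = L + 1 ∧ p w} =
      List.cons true '' {w : List Bool | w.length = L ∧ p (true :: w)} ∪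
        List.cons false '' {w : List Bool | w.length = L ∧ p (false :: w)} := by
    ext w
    rcases w with _ | ⟨_ | _, w⟩ <;> simp
  rw [hunion, Set.ncard_union_eq _ ((hfin _).image _) ((hfin _).image _),
    Set.ncard_image_of_injective _ List.cons_injective,
    Set.ncard_image_of_injective _ List.cons_injective]
  rw [Set.disjoint_left]
  rintro _ ⟨v, -, rfl⟩ ⟨w, -, hw⟩
  simp at hw

theorem descentCount_succ_zero (L r : ℕ) :
    descentCount (L + 1) 0 r = descentCount L 1 r := by
  simp [descentCount, ncard_length_succ, DescendsToZero]

theorem descentCount_succ_one (L r : ℕ) :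
    descentCount (L + 1) 1 r = descentCount L 2 r + descentCount L 0 (r - 1) := by
  simp [descentCount, ncard_length_succ, DescendsToZero]

theorem descentCount_succ_add_two (L h r : ℕ) :
    descentCount (L + 1) (h + 2) r = descentCount L (h + 3) r + descentCount L (h + 1) r := by
  simp [descentCount, ncard_length_succ, DescendsToZero]

theorem descentCount_eq_zero {L h r : ℕ} (H : L < h ∨ L + h < 2 * r) :
    descentCount L h r = 0 := by
  have : {w : List Bool | w.length = L ∧ DescendsToZero w h r} = ∅ := by
    ext w
    simp only [Set.mem_ofPred_eq, Set.mem_empty_iff_false, iff_false]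
    rintro ⟨rfl, hw⟩
    have := hw.le_length
    omega
  rw [descentCount, this, Set.ncard_empty]

theorem descentCount_succ_right_zero (L h : ℕ) :
    descentCount L (h + 1) 0 = descentCount L (h + 1) 1 := by
  induction L generalizing h with
  | zero => simp [descentCount_zero]
  | succ L ih =>
    cases h with
    | zero => simp [descentCount_succ_one, ih 1]
    | succ h => simp only [descentCount_succ_add_two, ih]

theorem descentCount_add_choose (L : ℕ) :
    (∀ u r, L = 2 * u → r ≤ u →
      descentCount L 0 r + (L - r).choose (u + 1) = (L - r).choose u) ∧
    (∀ u h s, L = 2 * u + (h + 1) → s ≤ u + h →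
      descentCount L (h + 1) (s + 1) + (L - s).choose (u + h + 2)
        = (L - s).choose (u + h + 1)) := by
  induction L with
  | zero =>
    constructor
    · intro u r hu hr
      obtain rfl : u = 0 := by omega
      obtain rfl : r = 0 := by omega
      simp [descentCount_zero]
    · intros
      omega
  | succ L ih =>
    obtain ⟨ih₀, ih₁⟩ := ih
    constructor
    · intro u r hu hr
      obtain ⟨v, rfl⟩ : ∃ v, u = v + 1 := ⟨u - 1, by omega⟩
      rw [descentCount_succ_zero]
      cases r with
      | zero =>
        have h₁ := ih₁ v 0 0 (by omega) (by omega)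
        have h₂ : L.choose v = L.choose (v + 1) := Nat.choose_symm_of_eq_add (by omega)
        simp only [zero_add, Nat.sub_zero, add_zero] at h₁
        rw [descentCount_succ_right_zero L 0, Nat.sub_zero, Nat.choose_succ_succ,
          Nat.choose_succ_succ L v]
        simp only [zero_add, Nat.succ_eq_add_one, add_assoc, Nat.reduceAdd] at *
        omega
      | succ s =>
        rw [Nat.add_sub_add_right]
        exact ih₁ v 0 s (by omega) (by omega)
    · intro u h s hL hs
      have hup : descentCount L (h + 2) (s + 1) + (L - s).choose (u + h + 2)
          = (L - s).choose (u + h + 1) := by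
        cases u with
        | zero =>
          rw [descentCount_eq_zero (by omega), Nat.choose_eq_zero_of_lt (by omega),
            Nat.choose_eq_zero_of_lt (by omega)]
        | succ v =>
          have := ih₁ v (h + 1) s (by omega) (by omega)
          convert this using 3 <;> omega
      rw [Nat.sub_add_comm (by omega : s ≤ L), Nat.choose_succ_succ, Nat.choose_succ_succ]
      simp only [Nat.succ_eq_add_one]
      cases h with
      | zero =>
        have hdown := ih₀ u s (by omega) (by omega)
        rw [descentCount_succ_one]
        simp only [zero_add, add_zero, add_assoc, Nat.reduceAdd, Nat.add_sub_cancel] at *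
        omega
      | succ h =>
        have hdown : descentCount L (h + 1) (s + 1) + (L - s).choose (u + h + 2)
            = (L - s).choose (u + h + 1) := by
          by_cases hs' : s ≤ u + h
          · exact ih₁ u h s (by omega) hs'
          · rw [descentCount_eq_zero (by omega), Nat.choose_eq_zero_of_lt (by omega),
              Nat.choose_eq_zero_of_lt (by omega)]
        rw [descentCount_succ_add_two]
        simp only [add_assoc, Nat.reduceAdd] at *
        omega

theorem catalanTriangle_sub_eq_descentCount {m r : ℕ} (hr : r ≤ m) :
    catalanTriangle m (m - r) = descentCount (2 * m) 0 r := by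
  have H := (descentCount_add_choose (2 * m)).1 m r rfl hr
  have h₁ : (2 * m - r).choose (m - r) = (2 * m - r).choose m :=
    Nat.choose_symm_of_eq_add (by omega)
  have h₂ : (if m - r = 0 then 0 else (2 * m - r).choose (m - r - 1))
      = (2 * m - r).choose (m + 1) := by
    split_ifs with h
    · rw [Nat.choose_eq_zero_of_lt (by omega)]
    · exact Nat.choose_symm_of_eq_add (by omega)
  rw [catalanTriangle, show m + (m - r) = 2 * m - r by omega, h₁, h₂]
  omega

open Classical in
theorem sum_dyckCount_eq_descentCount (m r : ℕ) :
    ∑ j ∈ Finset.Icc r m, dyckCount m j = descentCount (2 * m) 0 r := by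
  have hfin : {w : List Bool | w.length = 2 * m ∧ DescendsToZero w 0 r}.Finite :=
    (List.finite_length_eq Bool (2 * m)).subset fun w hw => hw.1
  rw [descentCount, Set.ncard_eq_toFinset_card _ hfin,
    Finset.card_eq_sum_card_fiberwise (f := dyckReturns) (t := Finset.Icc r m)]
  · refine Finset.sum_congr rfl fun j hj => ?_
    rw [dyckCount, ← Set.ncard_coe_finset]
    congr 1
    ext w
    have := (Finset.mem_Icc.1 hj).1
    simp only [Set.mem_ofPred_eq, Finset.coe_filter, Set.Finite.mem_toFinset,
      descendsToZero_zero_iff]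
    grind
  · intro w hw
    simp only [Set.Finite.coe_toFinset, Set.mem_ofPred_eq, descendsToZero_zero_iff] at hw
    have := ((descendsToZero_zero_iff w _).2 ⟨hw.2.1, le_rfl⟩).le_length.2
    simp only [Finset.coe_Icc, Set.mem_Icc]
    omega

/-- For 1 ≤ k ≤ n, the Catalan triangle entry C(n-1, n-k) counts the Dyck words
of semilength n-1 with at least k-1 returns. -/
theorem catalanTriangle_eq_sum_dyckCount (n k : ℕ) (hk : 1 ≤ k) (hkn : k ≤ n) :
    catalanTriangle (n - 1) (n - k)
      = ∑ j ∈ Finset.Icc (k - 1) (n - 1), dyckCount (n - 1) j := by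
  rw [sum_dyckCount_eq_descentCount, ← catalanTriangle_sub_eq_descentCount (by omega)]
  congr 1
  omega
end

section
/- Let δ ≥ 1 and let G be a δ-regular tree. For every vertex v and every n ≥ 1, the number W_{2n} of closed walks of length 2n at v satisfies W_{2n} = ∑_{k=1}^{n} δ^k·(δ−1)^{n−k}·C(n−1, n−k), where C(n,k) is the Catalan triangle entry. -/
open Finset

/-- The coefficient of `x ^ i` in the `r`-th power of the generating series of the Catalan
numbers. -/
def catalanPowCoeff (r : ℕ) : ℕ → ℕ
  | 0 => 1
  | i + 1 => (r + 2 * i + 1).choose (i + 1) - (r + 2 * i + 1).choose i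

lemma catalanPowCoeff_succ_eq_catalanTriangle (r i : ℕ) :
    catalanPowCoeff (r + 1) i = catalanTriangle (r + i) i := by
  cases i with
  | zero => simp [catalanPowCoeff, catalanTriangle]
  | succ i =>
    simp only [catalanPowCoeff, catalanTriangle, Nat.add_one_ne_zero, if_false,
      Nat.add_sub_cancel]
    congr 2 <;> ring

lemma catalanPowCoeff_zero_succ (i : ℕ) : catalanPowCoeff 0 (i + 1) = 0 := by
  simp [catalanPowCoeff, Nat.choose_symm_half]

lemma Nat.choose_le_choose_succ_of_two_mul_lt {n i : ℕ} (h : 2 * i < n) :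
    n.choose i ≤ n.choose (i + 1) := by
  refine Nat.le_of_mul_le_mul_right ?_ i.succ_pos
  rw [Nat.succ_eq_add_one, Nat.choose_succ_right_eq]
  exact Nat.mul_le_mul_left _ (by omega)

lemma catalanPowCoeff_succ_succ (r i : ℕ) :
    catalanPowCoeff (r + 1) (i + 1) = catalanPowCoeff r (i + 1) + catalanPowCoeff (r + 2) i := by
  cases i with
  | zero => simp [catalanPowCoeff]
  | succ i =>
    simp only [catalanPowCoeff]
    have h₁ := Nat.choose_le_choose_succ_of_two_mul_lt (n := r + 2 * i + 3) (i := i + 1) (by omega)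
    have h₂ := Nat.choose_le_choose_succ_of_two_mul_lt (n := r + 2 * i + 3) (i := i) (by omega)
    rw [show r + 1 + 2 * (i + 1) + 1 = r + 2 * i + 3 + 1 by ring,
      show r + 2 * (i + 1) + 1 = r + 2 * i + 3 by ring,
      show r + 2 + 2 * i + 1 = r + 2 * i + 3 by ring,
      Nat.choose_succ_succ' (r + 2 * i + 3) (i + 1), Nat.choose_succ_succ' (r + 2 * i + 3) i]
    omega

/-- The number of walks of length `m` in the `δ`-regular tree between two given vertices at
distance `d`, defined by recursion on the length. -/
def regularTreeWalkCount (δ : ℕ) : ℕ → ℕ → ℕ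
  | 0, 0 => 1
  | 0, _ + 1 => 0
  | m + 1, 0 => δ * regularTreeWalkCount δ m 1
  | m + 1, d + 1 => regularTreeWalkCount δ m d + (δ - 1) * regularTreeWalkCount δ m (d + 2)

lemma regularTreeWalkCount_eq_zero_of_lt (δ : ℕ) {m d : ℕ} (h : m < d) :
    regularTreeWalkCount δ m d = 0 := by
  induction m generalizing d with
  | zero => obtain ⟨d, rfl⟩ := Nat.exists_eq_succ_of_ne_zero h.ne'; rfl
  | succ m ih =>
    obtain ⟨d, rfl⟩ := Nat.exists_eq_succ_of_ne_zero (Nat.ne_zero_of_lt h)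
    simp [regularTreeWalkCount, ih (show m < d by omega), ih (show m < d + 2 by omega)]

/-- Closed form of the walk count: `p.1` is the number of steps that leave the target vertex. -/
lemma regularTreeWalkCount_eq_sum_antidiagonal (δ m : ℕ) {d j : ℕ} (h : m = d + 2 * j) :
    regularTreeWalkCount δ m d =
      ∑ p ∈ antidiagonal j, δ ^ p.1 * (δ - 1) ^ p.2 * catalanPowCoeff (d + p.1) p.2 := by
  induction m generalizing d j with
  | zero =>
    obtain ⟨rfl, rfl⟩ : d = 0 ∧ j = 0 := by omega
    simp [regularTreeWalkCount, catalanPowCoeff]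
  | succ m ih =>
    cases d with
    | zero =>
      obtain ⟨j, rfl⟩ : ∃ i, j = i + 1 := ⟨j - 1, by omega⟩
      rw [regularTreeWalkCount, ih (j := j) (by omega), Nat.sum_antidiagonal_succ, mul_sum]
      simp only [add_zero, catalanPowCoeff_zero_succ, mul_zero, zero_add]
      refine sum_congr rfl fun p _ => ?_
      rw [add_comm 1]
      ring
    | succ d =>
      rw [regularTreeWalkCount, ih (d := d) (j := j) (by omega)]
      cases j with
      | zero =>
        simp [regularTreeWalkCount_eq_zero_of_lt δ (show m < d + 2 by omega), catalanPowCoeff]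
      | succ j =>
        rw [ih (d := d + 2) (j := j) (by omega), Nat.sum_antidiagonal_succ',
          Nat.sum_antidiagonal_succ', mul_sum, add_assoc, ← sum_add_distrib]
        congr 1
        refine sum_congr rfl fun p _ => ?_
        rw [add_right_comm d 1, catalanPowCoeff_succ_succ, add_right_comm d 2]
        ring

namespace SimpleGraph

variable {V : Type*} {G : SimpleGraph V}

lemma IsAcyclic.eq_of_adj_of_dist_eq_add_one (hG : G.IsAcyclic) {u v w w' : V}
    (hw : G.Adj u w) (hw' : G.Adj u w') (hv : G.Reachable u v)
    (h : G.dist u v = G.dist w v + 1) (h' : G.dist u v = G.dist w' v + 1) : w = w' := by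
  obtain ⟨p, hp⟩ := (hw.symm.reachable.trans hv).exists_walk_length_eq_dist
  obtain ⟨q, hq⟩ := (hw'.symm.reachable.trans hv).exists_walk_length_eq_dist
  have hp' : (Walk.cons hw p).IsPath := Walk.isPath_of_length_eq_dist _ (by simp [hp, h])
  have hq' : (Walk.cons hw' q).IsPath := Walk.isPath_of_length_eq_dist _ (by simp [hq, h'])
  have := congrArg (fun r : G.Path u v => r.1.snd)
    ((hG.subsingleton_path u v).elim ⟨_, hp'⟩ ⟨_, hq'⟩)
  simpa using this

lemma Reachable.exists_adj_dist_eq_add_one {u v : V} (h : G.Reachable u v) (hne : u ≠ v) :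
    ∃ w, G.Adj u w ∧ G.dist u v = G.dist w v + 1 := by
  obtain ⟨p, hp⟩ := h.exists_walk_length_eq_dist
  cases p with
  | nil => exact absurd rfl hne
  | @cons _ w _ hw p =>
    refine ⟨w, hw, ?_⟩
    have h₁ := dist_le p
    obtain ⟨q, hq⟩ := p.reachable.exists_walk_length_eq_dist
    have h₂ := dist_le (Walk.cons hw q)
    simp only [Walk.length_cons] at hp h₂
    omega

lemma card_finsetWalkLength_succ [DecidableEq V] [G.LocallyFinite] (n : ℕ) (u v : V) :
    #(G.finsetWalkLength (n + 1) u v) = ∑ w ∈ G.neighborFinset u, #(G.finsetWalkLength n w v) := by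
  rw [finsetWalkLength, card_biUnion]
  · simp only [card_map]
    exact (sum_subtype _ (fun w => by simp) fun w => #(G.finsetWalkLength n w v)).symm
  · rintro ⟨x, hx⟩ - ⟨y, hy⟩ - hxy
    rw [Function.onFun]
    refine Finset.disjoint_left.2 fun r hr hr' => ?_
    obtain ⟨p, -, rfl⟩ := mem_map.1 hr
    obtain ⟨q, -, h⟩ := mem_map.1 hr'
    cases h
    exact hxy rfl

lemma IsTree.sum_neighborFinset_dist [G.LocallyFinite] (hG : G.IsTree) {u v : V} (huv : u ≠ v)
    (f : ℕ → ℕ) :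
    ∑ w ∈ G.neighborFinset u, f (G.dist w v) =
      f (G.dist u v - 1) + (G.degree u - 1) * f (G.dist u v + 1) := by
  classical
  obtain ⟨w, hw, hd⟩ := (hG.connected u v).exists_adj_dist_eq_add_one huv
  have hmem : w ∈ G.neighborFinset u := (G.mem_neighborFinset u w).2 hw
  rw [← add_sum_erase _ _ hmem, hd, Nat.add_sub_cancel, ← hd, ← card_neighborFinset_eq_degree,
    ← card_erase_of_mem hmem, ← smul_eq_mul, ← sum_const]
  congr 1
  refine sum_congr rfl fun x hx => ?_
  rw [mem_erase, mem_neighborFinset] at hx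
  have hx' := hG.dist_eq_dist_add_one_of_adj v hx.2
  rw [dist_comm, dist_comm (u := v) (v := x)] at hx'
  rcases hx' with h | h
  · exact absurd (hG.isAcyclic.eq_of_adj_of_dist_eq_add_one hx.2 hw (hG.connected u v) h hd) hx.1
  · rw [h]

lemma IsTree.card_finsetWalkLength [DecidableEq V] [G.LocallyFinite] {δ : ℕ} (hG : G.IsTree)
    (hreg : G.IsRegularOfDegree δ) (m : ℕ) (u v : V) :
    #(G.finsetWalkLength m u v) = regularTreeWalkCount δ m (G.dist u v) := by
  induction m generalizing u with
  | zero =>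
    obtain rfl | h := eq_or_ne u v
    · simp [finsetWalkLength, regularTreeWalkCount]
    · obtain ⟨d, hd⟩ := Nat.exists_eq_succ_of_ne_zero (hG.connected.pos_dist_of_ne h).ne'
      simp [finsetWalkLength, h, hd, regularTreeWalkCount]
  | succ m ih =>
    simp only [card_finsetWalkLength_succ, ih]
    obtain rfl | h := eq_or_ne u v
    · have : ∀ w ∈ G.neighborFinset u, regularTreeWalkCount δ m (G.dist w u) =
          regularTreeWalkCount δ m 1 := fun w hw => by
        rw [dist_eq_one_iff_adj.2 ((G.mem_neighborFinset u w).1 hw).symm]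
      rw [sum_congr rfl this, sum_const, card_neighborFinset_eq_degree, hreg.degree_eq, dist_self,
        regularTreeWalkCount, smul_eq_mul]
    · obtain ⟨d, hd⟩ := Nat.exists_eq_succ_of_ne_zero (hG.connected.pos_dist_of_ne h).ne'
      rw [hG.sum_neighborFinset_dist h, hreg.degree_eq, hd]
      rfl

end SimpleGraph

/-- In a δ-regular tree, the number of closed walks of length 2n at a vertex v
equals the stated sum of Catalan triangle entries. -/
theorem closed_walks_eq_catalanTriangle_sum {V : Type*} (G : SimpleGraph V)
    [G.LocallyFinite] (δ : ℕ) (hδ : 1 ≤ δ)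
    (hreg : G.IsRegularOfDegree δ) (htree : G.IsTree) (v : V)
    (n : ℕ) (hn : 1 ≤ n) :
    Set.ncard {p : G.Walk v v | p.length = 2 * n}
      = ∑ k ∈ Finset.Icc 1 n,
          δ ^ k * (δ - 1) ^ (n - k) * catalanTriangle (n - 1) (n - k) := by
  classical
  rw [← G.coe_finsetWalkLength_eq, Set.ncard_coe_finset, htree.card_finsetWalkLength hreg,
    SimpleGraph.dist_self, regularTreeWalkCount_eq_sum_antidiagonal δ _ (zero_add _).symm]
  obtain ⟨m, rfl⟩ : ∃ m, n = m + 1 := ⟨n - 1, by omega⟩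
  rw [Finset.Nat.sum_antidiagonal_succ]
  simp only [zero_add, catalanPowCoeff_zero_succ, mul_zero]
  rw [← Finset.Ico_add_one_right_eq_Icc, Finset.sum_Ico_eq_sum_range,
    Finset.Nat.sum_antidiagonal_eq_sum_range_succ_mk]
  refine Finset.sum_congr rfl fun k hk => ?_
  have hk' := Finset.mem_range_succ_iff.1 hk
  rw [catalanPowCoeff_succ_eq_catalanTriangle, Nat.add_sub_cancel' hk', add_comm 1 k,
    Nat.add_sub_add_right, Nat.add_sub_cancel]
end
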